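/- arXiv:2403.03749 — 2 statements merged into one kernel-verified Lean document; each statement's English description precedes it below -/
import Mathlib

section
/- For every nonnegative integer n and all u, v ∈ ℂ, (u − v) · Σ_{ℓ=0}^{n} ((2ℓ+1)·(n−ℓ)!/(n+ℓ+1)!) · (u v)^ℓ · L_{n−ℓ}^{2ℓ+1}(u) · L_{n−ℓ}^{2ℓ+1}(v) = u · L_n^1(u) · L_{n+1}(v) − v · L_n^1(v) · L_{n+1}(u). -/
open scoped BigOperators

noncomputable section

/-- The generalized Laguerre polynomial `L_n^α(x) = ∑_{k=0}^n (-1)^k binom(n+α, n-k) x^k / k!`. -/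
def laguerreL (α n : ℕ) (x : ℂ) : ℂ :=
  ∑ k ∈ Finset.range (n + 1),
    (-1) ^ k * ((n + α).choose (n - k) : ℂ) * x ^ k / (k.factorial : ℂ)

/-- `L_{n-1}^α(x)`, with the convention `L_{-1}^α = 0`. -/
def laguerrePred (α : ℕ) : ℕ → ℂ → ℂ
  | 0, _ => 0
  | n + 1, x => laguerreL α n x

theorem laguerrePred_succ (α n : ℕ) (x : ℂ) : laguerrePred α (n + 1) x = laguerreL α n x :=
  rfl

/-- `L_n^α = L_n^{α+1} - L_{n-1}^{α+1}`. -/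
theorem laguerreL_eq_sub_pred (α n : ℕ) (x : ℂ) :
    laguerreL α n x = laguerreL (α + 1) n x - laguerrePred (α + 1) n x := by
  cases n with
  | zero => simp [laguerreL, laguerrePred]
  | succ n =>
    simp only [laguerreL, laguerrePred]
    rw [Finset.sum_range_succ, Finset.sum_range_succ _ (n + 1), add_sub_right_comm,
      ← Finset.sum_sub_distrib]
    congr 1
    · refine Finset.sum_congr rfl fun k hk => ?_
      obtain ⟨j, rfl⟩ := Nat.exists_eq_add_of_le (Nat.le_of_lt_succ (Finset.mem_range.1 hk))
      have h : ((k + j + 1 + (α + 1)).choose (k + j + 1 - k) : ℂ) =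
          ((k + j + (α + 1)).choose (k + j - k) : ℂ) +
            ((k + j + 1 + α).choose (k + j + 1 - k) : ℂ) := by
        rw [show k + j + 1 + (α + 1) = (k + j + 1 + α) + 1 by ring,
          show k + j + 1 - k = j + 1 by omega, show k + j - k = j by omega,
          show k + j + (α + 1) = k + j + 1 + α by ring]
        exact_mod_cast Nat.choose_succ_succ _ _
      rw [h]
      ring
    · simp

/-- `x L_n^{α+1} = (n + α + 1) L_n^α - (n + 1) L_{n+1}^α`. -/
theorem mul_laguerreL_succ (α n : ℕ) (x : ℂ) :
    x * laguerreL (α + 1) n x =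
      (n + α + 1) * laguerreL α n x - (n + 1) * laguerreL α (n + 1) x := by
  have absorb (j : ℕ) : ((n + α + 1 : ℕ) : ℂ) * ((n + α).choose j : ℂ) =
      ((n + α + 1).choose (j + 1) : ℂ) * ((j + 1 : ℕ) : ℂ) := by
    exact_mod_cast Nat.add_one_mul_choose_eq (n + α) j
  have hT : n + 1 + α = n + α + 1 := by ring
  have hT' : n + (α + 1) = n + α + 1 := by ring
  simp only [laguerreL, hT, hT']
  rw [Finset.sum_range_succ _ n, Finset.sum_range_succ' _ (n + 1), Finset.sum_range_succ' _ n,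
    Finset.sum_range_succ _ n]
  have h0 := absorb n
  push_cast at h0
  have hsum : x * ∑ k ∈ Finset.range n,
      (-1) ^ k * ((n + α + 1).choose (n - k) : ℂ) * x ^ k / (k.factorial : ℂ) =
      (n + α + 1) * ∑ k ∈ Finset.range n, (-1) ^ (k + 1) *
        ((n + α).choose (n - (k + 1)) : ℂ) * x ^ (k + 1) / ((k + 1).factorial : ℂ) -
      (n + 1) * ∑ k ∈ Finset.range n, (-1) ^ (k + 1) *
        ((n + α + 1).choose (n + 1 - (k + 1)) : ℂ) * x ^ (k + 1) / ((k + 1).factorial : ℂ) := by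
    simp only [Finset.mul_sum, ← Finset.sum_sub_distrib]
    refine Finset.sum_congr rfl fun k hk => ?_
    obtain ⟨j, rfl⟩ := Nat.exists_eq_add_of_lt (Finset.mem_range.1 hk)
    have h := absorb j
    rw [show k + j + 1 - k = j + 1 by omega, show k + j + 1 - (k + 1) = j by omega,
      show k + j + 1 + 1 - (k + 1) = j + 1 by omega, Nat.factorial_succ]
    have hk1 : (k : ℂ) + 1 ≠ 0 := Nat.cast_add_one_ne_zero k
    have hkf : (k.factorial : ℂ) ≠ 0 := Nat.cast_ne_zero.2 k.factorial_ne_zero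
    push_cast at h ⊢
    field_simp
    linear_combination x ^ (k + 1) * (-1) ^ k * h
  have hn1 : (n : ℂ) + 1 ≠ 0 := Nat.cast_add_one_ne_zero n
  have hnf : (n.factorial : ℂ) ≠ 0 := Nat.cast_ne_zero.2 n.factorial_ne_zero
  have hlast : x * ((-1) ^ n * ((n + α + 1).choose (n - n) : ℂ) * x ^ n / (n.factorial : ℂ)) =
      -(n + 1) * ((-1) ^ (n + 1) * ((n + α + 1).choose (n + 1 - (n + 1)) : ℂ) * x ^ (n + 1) /
        ((n + 1).factorial : ℂ)) := by
    rw [Nat.factorial_succ]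
    simp only [Nat.sub_self, Nat.choose_zero_right]
    push_cast
    field_simp
    ring
  simp only [Nat.sub_zero, pow_zero, Nat.factorial_zero, Nat.cast_one, div_one, mul_one, one_mul]
  linear_combination hsum + hlast - h0

/-- `x L_{n-1}^{α+1} = (n + α) L_{n-1}^α - n L_n^α`. -/
theorem mul_laguerrePred_succ (α n : ℕ) (x : ℂ) :
    x * laguerrePred (α + 1) n x = (n + α) * laguerrePred α n x - n * laguerreL α n x := by
  cases n with
  | zero => simp [laguerrePred]
  | succ n =>
    simp only [laguerrePred]
    rw [mul_laguerreL_succ]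
    push_cast
    ring

/-- `x² L_{n-1}^{α+3}` in terms of `L_n^{α+1}` and `L_n^α`. -/
theorem sq_mul_laguerrePred (α n : ℕ) (x : ℂ) :
    x ^ 2 * laguerrePred (α + 3) n x =
      ((α + 1) * (α + 2) - n * x) * laguerreL (α + 1) n x -
        (α + 2) * (n + α + 1) * laguerreL α n x := by
  have h1 := mul_laguerrePred_succ (α + 2) n x
  have h2 := mul_laguerrePred_succ (α + 1) n x
  have h3 := laguerreL_eq_sub_pred α n x
  have h4 := mul_laguerreL_succ (α + 1) n x
  have h5 := laguerreL_eq_sub_pred α (n + 1) x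
  have h6 := mul_laguerreL_succ α n x
  simp only [laguerrePred] at h5
  push_cast at *
  linear_combination x * h1 + (n + α + 2) * h2 - n * h4 + (n + α + 2) * (n + α + 1) * h3
    - n * (n + 1) * h5 + n * h6

/-- The three-term relation between `L_{n-1}^{α+4}`, `L_n^{α+2}` and `L_{n+1}^α`. -/
theorem laguerre_three_term (α n : ℕ) (x : ℂ) :
    (α + 1) * (x ^ 2 * laguerrePred (α + 4) n x) +
        (α + 3) * (n + α + 2) * (n + 1) * laguerreL α (n + 1) x =
      (α + 2) * ((α + 1) * (α + 3) - x * (2 * n + α + 3)) * laguerreL (α + 2) n x := by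
  have h1 := sq_mul_laguerrePred (α + 1) n x
  have h2 := laguerreL_eq_sub_pred α (n + 1) x
  have h3 := mul_laguerreL_succ (α + 1) n x
  simp only [laguerrePred] at h2
  push_cast at *
  linear_combination (α + 1) * h1 + (α + 3) * (n + α + 2) * (n + 1) * h2
    + (α + 3) * (n + α + 2) * h3

/-- Partial sums of the addition formula: the sum over `ℓ` telescopes, with a remainder given by
a Casoratian of consecutive terms. -/
theorem laguerre_addition_partial_sum (m p : ℕ) (u v : ℂ) :
    (u - v) *
        ∑ ℓ ∈ Finset.range (m + 1),
          ((2 * ℓ + 1 : ℕ) : ℂ) * ((m + p - ℓ).factorial : ℂ) / ((m + p + ℓ + 1).factorial : ℂ) *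
            (u * v) ^ ℓ * laguerreL (2 * ℓ + 1) (m + p - ℓ) u *
              laguerreL (2 * ℓ + 1) (m + p - ℓ) v =
      u * laguerreL 1 (m + p) u * laguerreL 0 (m + p + 1) v -
        v * laguerreL 1 (m + p) v * laguerreL 0 (m + p + 1) u +
      (p.factorial : ℂ) / ((2 * m + p + 1).factorial : ℂ) * (u * v) ^ (m + 1) / (2 * (m + 1)) *
        (v * laguerreL (2 * m + 1) p u * laguerrePred (2 * m + 3) p v -
          u * laguerreL (2 * m + 1) p v * laguerrePred (2 * m + 3) p u) := by
  induction m generalizing p with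
  | zero =>
    have hu := sq_mul_laguerrePred 0 p u
    have hv := sq_mul_laguerrePred 0 p v
    have hu' := mul_laguerreL_succ 0 p u
    have hv' := mul_laguerreL_succ 0 p v
    have hp : (p : ℂ) + 1 ≠ 0 := Nat.cast_add_one_ne_zero p
    have hpf : (p.factorial : ℂ) ≠ 0 := Nat.cast_ne_zero.2 p.factorial_ne_zero
    simp only [zero_add, Finset.sum_range_one, mul_zero, Nat.sub_zero, add_zero, pow_zero,
      Nat.factorial_succ, pow_one]
    push_cast at *
    simp only [zero_add, add_zero] at *
    field_simp
    linear_combination v * laguerreL 1 p v * hu - u * laguerreL 1 p u * hv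
      + 2 * v * laguerreL 1 p v * hu' - 2 * u * laguerreL 1 p u * hv'
  | succ m ih =>
    have hu := laguerre_three_term (2 * m + 1) p u
    have hv := laguerre_three_term (2 * m + 1) p v
    have hn : m + 1 + p = m + (p + 1) := by ring
    rw [Finset.sum_range_succ, mul_add, hn, ih (p + 1)]
    have hm1 : (m : ℂ) + 1 ≠ 0 := Nat.cast_add_one_ne_zero m
    have hm2 : (m : ℂ) + 2 ≠ 0 := by exact_mod_cast Nat.succ_ne_zero (m + 1)
    have hN : (2 * m + p + 3 : ℂ) ≠ 0 := by exact_mod_cast Nat.succ_ne_zero (2 * m + p + 2)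
    have hf : ((2 * m + p + 2).factorial : ℂ) ≠ 0 :=
      Nat.cast_ne_zero.2 (Nat.factorial_ne_zero _)
    rw [show m + (p + 1) - (m + 1) = p by omega,
      show m + (p + 1) + (m + 1) + 1 = 2 * m + p + 2 + 1 by ring,
      show 2 * m + (p + 1) + 1 = 2 * m + p + 2 by ring,
      show 2 * (m + 1) + p + 1 = 2 * m + p + 2 + 1 by ring,
      show 2 * (m + 1) + 1 = 2 * m + 3 by ring, show 2 * (m + 1) + 3 = 2 * m + 5 by ring,
      Nat.factorial_succ (2 * m + p + 2), Nat.factorial_succ p]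
    simp only [laguerrePred_succ]
    rw [show 2 * m + 1 + 4 = 2 * m + 5 by ring, show 2 * m + 1 + 2 = 2 * m + 3 by ring] at hu hv
    generalize laguerrePred (2 * m + 5) p u = Xu at *
    generalize laguerrePred (2 * m + 5) p v = Xv at *
    generalize laguerreL (2 * m + 3) p u = Pu at *
    generalize laguerreL (2 * m + 3) p v = Pv at *
    generalize laguerreL (2 * m + 1) (p + 1) u = Yu at *
    generalize laguerreL (2 * m + 1) (p + 1) v = Yv at *
    push_cast at *
    have key : (2 * (m : ℂ) + 3) * (u - v) * Pu * Pv =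
        u * v * (v * Pu * Xv - u * Pv * Xu) / (2 * (m + 2)) -
          (2 * m + p + 3) * (p + 1) * (v * Yu * Pv - u * Yv * Pu) / (2 * (m + 1)) := by
      field_simp
      linear_combination (v * Pv * hu - u * Pu * hv) / 2
    rw [show (2 * (m : ℂ) + p + 2 + 1) = 2 * m + p + 3 by ring,
      show ((m : ℂ) + 1 + 1) = m + 2 by ring]
    have hfac : (u - v) * ((2 * (m : ℂ) + 3) * p.factorial /
        ((2 * m + p + 3) * (2 * m + p + 2).factorial) * (u * v) ^ (m + 1) * Pu * Pv) =
        (p.factorial : ℂ) / ((2 * m + p + 3) * (2 * m + p + 2).factorial) * (u * v) ^ (m + 1) *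
          ((2 * (m : ℂ) + 3) * (u - v) * Pu * Pv) := by ring
    rw [hfac, key]
    field_simp
    ring

/-- The `γ = 0` specialization of the addition formula for the Laguerre polynomials,
cleared of the denominator `u - v`. -/
theorem laguerre_addition_gamma_zero (n : ℕ) (u v : ℂ) :
    (u - v) *
        ∑ ℓ ∈ Finset.range (n + 1),
          ((2 * ℓ + 1 : ℕ) : ℂ) * ((n - ℓ).factorial : ℂ) / ((n + ℓ + 1).factorial : ℂ) *
            (u * v) ^ ℓ * laguerreL (2 * ℓ + 1) (n - ℓ) u * laguerreL (2 * ℓ + 1) (n - ℓ) v =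
      u * laguerreL 1 n u * laguerreL 0 (n + 1) v -
        v * laguerreL 1 n v * laguerreL 0 (n + 1) u := by
  simpa [laguerrePred] using laguerre_addition_partial_sum n 0 u v
end
end

section
/- For every nonnegative integer n and all u, v ∈ ℂ, Σ_{ℓ=0}^{n} (−1)^ℓ · ((2ℓ+1)·(n−ℓ)!/(n+ℓ+1)!) · (u v)^ℓ · L_{n−ℓ}^{2ℓ+1}(u) · L_{n−ℓ}^{2ℓ+1}(v) = L_n^1(u + v). -/
open scoped BigOperators

noncomputable section

open Finset

/-- The reciprocal factorial `1 / (a - l)!`, extended by zero to `l > a`. -/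
def invFactorialSub (a l : ℕ) : ℂ := if l ≤ a then (((a - l).factorial : ℕ) : ℂ)⁻¹ else 0

lemma invFactorialSub_of_le {a l : ℕ} (h : l ≤ a) :
    invFactorialSub a l = (((a - l).factorial : ℕ) : ℂ)⁻¹ := if_pos h

lemma invFactorialSub_of_lt {a l : ℕ} (h : a < l) : invFactorialSub a l = 0 :=
  if_neg (by omega)

lemma invFactorialSub_succ_succ (a l : ℕ) :
    invFactorialSub (a + 1) (l + 1) = invFactorialSub a l := by
  simp [invFactorialSub]

lemma invFactorialSub_eq_mul_succ_left (a l : ℕ) :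
    invFactorialSub a l = ((a : ℂ) + 1 - l) * invFactorialSub (a + 1) l := by
  rcases lt_trichotomy l (a + 1) with h | rfl | h
  · obtain ⟨d, rfl⟩ := Nat.exists_eq_add_of_le (Nat.lt_succ_iff.mp h)
    rw [invFactorialSub_of_le (by omega), invFactorialSub_of_le (by omega),
      show l + d - l = d by omega, show l + d + 1 - l = d + 1 by omega, Nat.factorial_succ]
    have h1 : (d.factorial : ℂ) ≠ 0 := mod_cast d.factorial_ne_zero
    have h2 : (d : ℂ) + 1 ≠ 0 := mod_cast d.succ_ne_zero
    push_cast
    rw [show (l : ℂ) + d + 1 - l = d + 1 by ring]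
    field_simp
  · rw [invFactorialSub_of_lt (by omega)]
    push_cast
    ring
  · rw [invFactorialSub_of_lt (by omega), invFactorialSub_of_lt h, mul_zero]

lemma invFactorialSub_succ_right (a l : ℕ) :
    invFactorialSub a (l + 1) = ((a : ℂ) - l) * invFactorialSub a l := by
  rw [invFactorialSub_eq_mul_succ_left, invFactorialSub_succ_succ]
  push_cast
  ring

/-- The summand of a terminating very-well-poised `₅F₄` series at `1`. -/
def wellPoisedTerm (n a b l : ℕ) : ℂ :=
  (-1) ^ l * (2 * l + 1) * (n - l).factorial * (n + l + 1).factorial /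
    ((a + l + 1).factorial * (b + l + 1).factorial) * invFactorialSub a l * invFactorialSub b l

/-- The Wilf–Zeilberger companion of `wellPoisedTerm`. -/
def wellPoisedCert (n a b l : ℕ) : ℂ :=
  -((-1) ^ l * l * (n + 1 - l).factorial * (n + l + 1).factorial /
    ((a + l + 1).factorial * (b + l).factorial) * invFactorialSub (a + 1) l * invFactorialSub b l)

lemma wellPoisedTerm_recurrence {n l : ℕ} (a b : ℕ) (hl : l ≤ n) :
    ((n : ℂ) - a) * (a + b + 2) * (a + 1) * wellPoisedTerm n (a + 1) b l
        - ((n : ℂ) - a - b) * wellPoisedTerm n a b l =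
      wellPoisedCert n a b (l + 1) - wellPoisedCert n a b l := by
  have ha : ((a + l + 1).factorial : ℂ) ≠ 0 := mod_cast Nat.factorial_ne_zero _
  have hb : ((b + l).factorial : ℂ) ≠ 0 := mod_cast Nat.factorial_ne_zero _
  have ha' : (a : ℂ) + l + 1 + 1 ≠ 0 := mod_cast (a + l + 1).succ_ne_zero
  have hb' : (b : ℂ) + l + 1 ≠ 0 := mod_cast (b + l).succ_ne_zero
  unfold wellPoisedTerm wellPoisedCert
  rw [invFactorialSub_eq_mul_succ_left a l, invFactorialSub_succ_right (a + 1) l,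
    invFactorialSub_succ_right b l, show a + 1 + l + 1 = a + l + 1 + 1 by ring,
    show a + (l + 1) + 1 = a + l + 1 + 1 by ring, show b + (l + 1) = b + l + 1 by ring,
    show n + (l + 1) + 1 = n + l + 1 + 1 by ring, show n + 1 - (l + 1) = n - l by omega,
    show n + 1 - l = n - l + 1 by omega, Nat.factorial_succ (a + l + 1),
    Nat.factorial_succ (b + l), Nat.factorial_succ (n + l + 1), Nat.factorial_succ (n - l),
    pow_succ]
  push_cast [Nat.cast_sub hl]
  field_simp
  ring

lemma sum_wellPoisedTerm {n a b : ℕ} (ha : a ≤ n) (hb : b ≤ n) :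
    ∑ l ∈ range (n + 1), wellPoisedTerm n a b l =
      (n - a).factorial * (n - b).factorial * (n + 1).factorial /
        ((a + b + 1).factorial * a.factorial * b.factorial) * invFactorialSub n (a + b) := by
  induction a with
  | zero =>
    rw [sum_eq_single 0]
    · have h : ((n - b).factorial : ℂ) ≠ 0 := mod_cast Nat.factorial_ne_zero _
      simp only [wellPoisedTerm, zero_add, add_zero]
      rw [invFactorialSub_of_le hb, invFactorialSub_of_le b.zero_le,
        invFactorialSub_of_le le_rfl]
      simp
      field_simp
    · intro l _ hl
      simp [wellPoisedTerm, invFactorialSub_of_lt (Nat.pos_of_ne_zero hl)]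
    · simp
  | succ a ih =>
    have hrec : ((n : ℂ) - a) * (a + b + 2) * (a + 1) *
          ∑ l ∈ range (n + 1), wellPoisedTerm n (a + 1) b l
        - ((n : ℂ) - a - b) * ∑ l ∈ range (n + 1), wellPoisedTerm n a b l = 0 := by
      rw [mul_sum, mul_sum, ← sum_sub_distrib,
        sum_congr rfl fun l hl =>
          wellPoisedTerm_recurrence a b (Nat.lt_succ_iff.mp (mem_range.mp hl)),
        sum_range_sub]
      simp [wellPoisedCert, invFactorialSub_of_lt (Nat.lt_succ_of_le hb)]
    rw [ih (by omega)] at hrec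
    obtain ⟨d, rfl⟩ := Nat.exists_eq_add_of_le ha
    have h1 : (d : ℂ) + 1 ≠ 0 := mod_cast d.succ_ne_zero
    have h2 : (a : ℂ) + b + 2 ≠ 0 := mod_cast (a + b + 1).succ_ne_zero
    have h3 : (a : ℂ) + 1 ≠ 0 := mod_cast a.succ_ne_zero
    have h4 : (a.factorial : ℂ) ≠ 0 := mod_cast a.factorial_ne_zero
    have h5 : (b.factorial : ℂ) ≠ 0 := mod_cast b.factorial_ne_zero
    have h6 : ((a + b + 1).factorial : ℂ) ≠ 0 := mod_cast Nat.factorial_ne_zero _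
    have h2' : (a : ℂ) + b + 1 + 1 ≠ 0 := mod_cast (a + b + 1).succ_ne_zero
    have h7 : ((a + 1 + d : ℕ) : ℂ) - a = d + 1 := by push_cast; ring
    rw [h7] at hrec
    have hne := mul_ne_zero (mul_ne_zero h1 h2) h3
    refine mul_left_cancel₀ hne ((sub_eq_zero.mp hrec).trans ?_)
    rw [show a + 1 + b = a + b + 1 by ring, invFactorialSub_succ_right _ (a + b),
      show a + 1 + d - a = d + 1 by omega, show a + 1 + d - (a + 1) = d by omega,
      Nat.factorial_succ d, Nat.factorial_succ a, Nat.factorial_succ (a + b + 1)]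
    push_cast
    field_simp
    ring

lemma choose_eq_div_factorial {N k a b : ℕ} (hk : N = k + a) (hb : a = b) :
    (N.choose k : ℂ) = N.factorial / (k.factorial * b.factorial) := by
  subst hk hb
  exact Nat.cast_add_choose ℂ

lemma pow_mul_laguerreL {n l : ℕ} (hl : l ≤ n) (x : ℂ) :
    x ^ l * laguerreL (2 * l + 1) (n - l) x =
      ∑ a ∈ range (n + 1), (-1) ^ (a + l) * (n + l + 1).factorial /
        ((n - a).factorial * (a + l + 1).factorial) * invFactorialSub a l * x ^ a := by
  obtain ⟨d, rfl⟩ := Nat.exists_eq_add_of_le hl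
  rw [laguerreL, mul_sum, show l + d + 1 = l + (d + 1) by ring, sum_range_add _ l,
    sum_eq_zero (s := range l), zero_add, show l + d - l = d by omega]
  · refine sum_congr rfl fun k hk => ?_
    have hk' : k ≤ d := Nat.lt_succ_iff.mp (mem_range.mp hk)
    rw [invFactorialSub_of_le (by omega), show l + k - l = k by omega,
      choose_eq_div_factorial (a := k + (2 * l + 1)) (b := l + k + l + 1) (by omega) (by omega),
      show d + (2 * l + 1) = l + d + l + 1 by ring, show l + d - (l + k) = d - k by omega,
      show l + k + l = k + 2 * l by ring, pow_add (-1 : ℂ) k, pow_mul, pow_add x]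
    norm_num
    ring
  · intro a ha
    simp [invFactorialSub_of_lt (mem_range.mp ha)]

lemma laguerreL_one_add (n : ℕ) (u v : ℂ) :
    laguerreL 1 n (u + v) = ∑ a ∈ range (n + 1), ∑ b ∈ range (n + 1),
      (-1) ^ (a + b) * (n + 1).factorial /
        ((a + b + 1).factorial * a.factorial * b.factorial) * invFactorialSub n (a + b) *
        u ^ a * v ^ b := by
  set f : ℕ → ℕ → ℂ := fun a b => (-1) ^ (a + b) * (n + 1).factorial /
        ((a + b + 1).factorial * a.factorial * b.factorial) * invFactorialSub n (a + b) *
        u ^ a * v ^ b with hf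
  have hflip := sum_range_diag_flip (n + 1) f
  trans ∑ m ∈ range (n + 1), ∑ k ∈ range (m + 1), f k (m - k)
  · refine sum_congr rfl fun m hm => ?_
    have hm' : m ≤ n := Nat.lt_succ_iff.mp (mem_range.mp hm)
    rw [add_pow, mul_sum, sum_div]
    refine sum_congr rfl fun k hk => ?_
    have hk' : k ≤ m := Nat.lt_succ_iff.mp (mem_range.mp hk)
    have h1 : (m.factorial : ℂ) ≠ 0 := mod_cast m.factorial_ne_zero
    simp only [hf]
    rw [show k + (m - k) = m by omega, invFactorialSub_of_le hm',
      choose_eq_div_factorial (N := n + 1) (a := m + 1) (by omega) rfl,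
      choose_eq_div_factorial (N := m) (k := k) (a := m - k) (by omega) rfl]
    field_simp
  · rw [hflip]
    refine sum_congr rfl fun a _ => sum_subset (range_subset_range.mpr (by omega)) ?_
    intro b _ hb
    have hlt : n < a + b := by
      rw [mem_range] at hb
      omega
    simp [hf, invFactorialSub_of_lt hlt]

/-- The `γ = π` specialization of the addition formula for the Laguerre polynomials. -/
theorem laguerre_addition_gamma_pi (n : ℕ) (u v : ℂ) :
    ∑ ℓ ∈ Finset.range (n + 1),
        (-1) ^ ℓ * (((2 * ℓ + 1 : ℕ) : ℂ) * ((n - ℓ).factorial : ℂ) / ((n + ℓ + 1).factorial : ℂ)) *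
          (u * v) ^ ℓ * laguerreL (2 * ℓ + 1) (n - ℓ) u * laguerreL (2 * ℓ + 1) (n - ℓ) v =
      laguerreL 1 n (u + v) := by
  calc
    _ = ∑ l ∈ range (n + 1), ∑ a ∈ range (n + 1), ∑ b ∈ range (n + 1),
        (-1) ^ (a + b) / (((n - a).factorial : ℂ) * (n - b).factorial) *
          wellPoisedTerm n a b l * u ^ a * v ^ b := by
      refine sum_congr rfl fun l hl => ?_
      have hl' : l ≤ n := Nat.lt_succ_iff.mp (mem_range.mp hl)
      trans (-1) ^ l * (((2 * l + 1 : ℕ) : ℂ) * ((n - l).factorial : ℂ) /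
        ((n + l + 1).factorial : ℂ)) * ((u ^ l * laguerreL (2 * l + 1) (n - l) u) *
          (v ^ l * laguerreL (2 * l + 1) (n - l) v))
      · rw [mul_pow]
        ring
      rw [pow_mul_laguerreL hl', pow_mul_laguerreL hl', sum_mul_sum, mul_sum]
      refine sum_congr rfl fun a _ => ?_
      rw [mul_sum]
      refine sum_congr rfl fun b _ => ?_
      have h : ((n + l + 1).factorial : ℂ) ≠ 0 := mod_cast Nat.factorial_ne_zero _
      have hs : ((-1 : ℂ) ^ l) ^ 2 = 1 := by rw [← pow_mul, mul_comm, pow_mul]; norm_num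
      simp only [wellPoisedTerm, pow_add]
      generalize (-1 : ℂ) ^ l = s at *
      generalize ((n + l + 1).factorial : ℂ) = F at *
      generalize ((n - l).factorial : ℂ) = G
      have hF : s ^ 3 * F ^ 2 * F⁻¹ = s * F := by
        rw [pow_succ, hs]
        field_simp
      push_cast
      linear_combination ((2 * l + 1) * G * (-1) ^ a * (-1) ^ b *
        ((n - a).factorial : ℂ)⁻¹ * ((n - b).factorial : ℂ)⁻¹ * ((a + l + 1).factorial : ℂ)⁻¹ *
        ((b + l + 1).factorial : ℂ)⁻¹ * invFactorialSub a l * invFactorialSub b l *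
        u ^ a * v ^ b) * hF
    _ = ∑ a ∈ range (n + 1), ∑ b ∈ range (n + 1),
        (-1) ^ (a + b) / (((n - a).factorial : ℂ) * (n - b).factorial) *
          (∑ l ∈ range (n + 1), wellPoisedTerm n a b l) * u ^ a * v ^ b := by
      rw [sum_comm]
      refine sum_congr rfl fun a _ => ?_
      rw [sum_comm]
      simp only [mul_sum, sum_mul]
    _ = laguerreL 1 n (u + v) := by
      rw [laguerreL_one_add]
      refine sum_congr rfl fun a ha => sum_congr rfl fun b hb => ?_
      rw [sum_wellPoisedTerm (Nat.lt_succ_iff.mp (mem_range.mp ha))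
        (Nat.lt_succ_iff.mp (mem_range.mp hb))]
      have h1 : ((n - a).factorial : ℂ) ≠ 0 := mod_cast Nat.factorial_ne_zero _
      have h2 : ((n - b).factorial : ℂ) ≠ 0 := mod_cast Nat.factorial_ne_zero _
      field_simp
end
end
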